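/- Let d≥3 and let V and Y be real Γ-periodic potentials on ℤ^d that are Fermi isospectral. If Y is completely separable, then V is completely separable. -/

import Mathlib

noncomputable section

/-- The discrete Laplacian on `ℤ^d`: `(Δu)(n) = Σ_{‖n'-n‖₁ = 1} u(n')`. -/
def discLap {d : ℕ} (u : (Fin d → ℤ) → ℂ) (n : Fin d → ℤ) : ℂ :=
  ∑ j : Fin d, (u (Function.update n j (n j + 1)) + u (Function.update n j (n j - 1)))

/-- Reduction of an integer modulo `q`, as an element of `Fin q`. -/
def fem (q : ℕ+) (a : ℤ) : Fin (q : ℕ) :=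
  ⟨(a % ((q : ℕ) : ℤ)).toNat, by
    have hq : (0:ℤ) < ((q : ℕ) : ℤ) := by exact_mod_cast q.pos
    have h1 : 0 ≤ a % ((q : ℕ) : ℤ) := Int.emod_nonneg a (ne_of_gt hq)
    have h2 : a % ((q : ℕ) : ℤ) < ((q : ℕ) : ℤ) := Int.emod_lt_of_pos a hq
    omega⟩

/-- Extension of a function on the fundamental domain `W` to `ℤ^d` using the
Floquet boundary conditions `u(n + qⱼ eⱼ) = zⱼ u(n)`. -/
def extendBC {d : ℕ} (q : Fin d → ℕ+) (z : Fin d → ℂ)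
    (u : (∀ j, Fin ((q j : ℕ))) → ℂ) : (Fin d → ℤ) → ℂ :=
  fun n => (∏ j, z j ^ (n j / ((q j : ℕ) : ℤ))) * u (fun j => fem (q j) (n j))

/-- The matrix `D_V(z)` of the Floquet reduction of `-Δ + V` to the fundamental domain. -/
def DVmat {d : ℕ} (q : Fin d → ℕ+) (V : (Fin d → ℤ) → ℂ) (z : Fin d → ℂ) :
    Matrix (∀ j, Fin ((q j : ℕ))) (∀ j, Fin ((q j : ℕ))) ℂ :=
  fun n n' =>
    -(discLap (extendBC q z (Pi.single n' 1)) (fun j => ((n j : ℕ) : ℤ)))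
      + V (fun j => ((n j : ℕ) : ℤ)) * (if n = n' then 1 else 0)

/-- `𝒫_V(z, λ) = det(D_V(z) - λ I)`. -/
def scriptP {d : ℕ} (q : Fin d → ℕ+) (V : (Fin d → ℤ) → ℂ) (z : Fin d → ℂ)
    (lam : ℂ) : ℂ :=
  Matrix.det (DVmat q V z - lam • (1 : Matrix (∀ j, Fin ((q j : ℕ))) (∀ j, Fin ((q j : ℕ))) ℂ))

/-- `Γ`-periodicity for a complex-valued function on `ℤ^d`. -/
def IsPeriodic {d : ℕ} (q : Fin d → ℕ+) (V : (Fin d → ℤ) → ℂ) : Prop :=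
  ∀ (n : Fin d → ℤ) (j : Fin d), V (Function.update n j (n j + ((q j : ℕ) : ℤ))) = V n

/-- `Γ`-periodicity for a real-valued function on `ℤ^d`. -/
def IsPeriodicR {d : ℕ} (q : Fin d → ℕ+) (V : (Fin d → ℤ) → ℝ) : Prop :=
  ∀ (n : Fin d → ℤ) (j : Fin d), V (Function.update n j (n j + ((q j : ℕ) : ℤ))) = V n

/-- `ρ_m = e^{2πi m / q}`. -/
def rho (q : ℕ+) (m : ℕ) : ℂ :=
  Complex.exp (2 * (Real.pi : ℂ) * Complex.I * (m : ℂ) / ((q : ℕ) : ℂ))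

/-- The discrete Fourier transform `V̂(l)` of a periodic potential. -/
def dft {d : ℕ} (q : Fin d → ℕ+) (V : (Fin d → ℤ) → ℂ) (l : Fin d → ℤ) : ℂ :=
  (1 / ((∏ j, (q j : ℕ) : ℕ) : ℂ)) * ∑ n : (∀ j, Fin ((q j : ℕ))),
    V (fun j => ((n j : ℕ) : ℤ)) *
      Complex.exp (-(2 * (Real.pi : ℂ) * Complex.I) * ∑ j, (l j : ℂ) * ((n j : ℕ) : ℂ) / ((q j : ℕ) : ℂ))

/-- The diagonal matrix `A(z)` with entries `-Σⱼ (ρʲ_{nⱼ} zⱼ + 1/(ρʲ_{nⱼ} zⱼ))`. -/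
def Amat {d : ℕ} (q : Fin d → ℕ+) (z : Fin d → ℂ) :
    Matrix (∀ j, Fin ((q j : ℕ))) (∀ j, Fin ((q j : ℕ))) ℂ :=
  Matrix.diagonal fun n => -(∑ j, (rho (q j) (n j) * z j + (rho (q j) (n j) * z j)⁻¹))

/-- The matrix `B_V` with entries `V̂(n - n')`. -/
def Bmat {d : ℕ} (q : Fin d → ℕ+) (V : (Fin d → ℤ) → ℂ) :
    Matrix (∀ j, Fin ((q j : ℕ))) (∀ j, Fin ((q j : ℕ))) ℂ :=
  fun n n' => dft q V (fun j => ((n j : ℕ) : ℤ) - ((n' j : ℕ) : ℤ))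

/-- The average `[V]` of a periodic potential. -/
def avgPot {d : ℕ} (q : Fin d → ℕ+) (V : (Fin d → ℤ) → ℂ) : ℂ :=
  (1 / ((∏ j, (q j : ℕ) : ℕ) : ℂ)) * ∑ n : (∀ j, Fin ((q j : ℕ))), V (fun j => ((n j : ℕ) : ℤ))

/-- The Fermi variety `F_λ(V)`. -/
def FermiVariety {d : ℕ} (q : Fin d → ℕ+) (V : (Fin d → ℤ) → ℂ) (lam : ℂ) :
    Set (Fin d → ℂ) :=
  {k | ∃ u : (Fin d → ℤ) → ℂ, u ≠ 0 ∧
    (∀ n, -(discLap u n) + V n * u n = lam * u n) ∧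
    (∀ (n : Fin d → ℤ) (j : Fin d),
      u (Function.update n j (n j + ((q j : ℕ) : ℤ)))
        = Complex.exp (2 * (Real.pi : ℂ) * Complex.I * k j) * u n)}

/-- Floquet isospectrality of two real periodic potentials. -/
def FloquetIso {d : ℕ} (q : Fin d → ℕ+) (V Y : (Fin d → ℤ) → ℝ) : Prop :=
  ∀ k : Fin d → ℝ,
    spectrum ℂ (DVmat q (fun n => ((V n : ℝ) : ℂ))
        (fun j => Complex.exp (2 * (Real.pi : ℂ) * Complex.I * (k j : ℂ))))
      = spectrum ℂ (DVmat q (fun n => ((Y n : ℝ) : ℂ))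
        (fun j => Complex.exp (2 * (Real.pi : ℂ) * Complex.I * (k j : ℂ))))

/-- A function on `(ℂ^*)^d` given by a Laurent polynomial. -/
def IsLaurent {d : ℕ} (f : (Fin d → ℂ) → ℂ) : Prop :=
  ∃ c : (Fin d → ℤ) →₀ ℂ, ∀ z : Fin d → ℂ, (∀ j, z j ≠ 0) →
    f z = c.sum fun a C => C * ∏ j, z j ^ a j

/-- A Laurent monomial `C z₁^{a₁} ⋯ z_d^{a_d}` with `C ≠ 0`. -/
def IsMonomial {d : ℕ} (f : (Fin d → ℂ) → ℂ) : Prop :=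
  ∃ (C : ℂ) (a : Fin d → ℤ), C ≠ 0 ∧ ∀ z : Fin d → ℂ, (∀ j, z j ≠ 0) →
    f z = C * ∏ j, z j ^ a j

/-- Irreducibility of a Laurent polynomial: no factorization into two non-monomial
Laurent polynomials. -/
def LaurentIrreducible {d : ℕ} (h : (Fin d → ℂ) → ℂ) : Prop :=
  ¬ ∃ f g : (Fin d → ℂ) → ℂ, IsLaurent f ∧ IsLaurent g ∧
      ¬ IsMonomial f ∧ ¬ IsMonomial g ∧
      ∀ z : Fin d → ℂ, (∀ j, z j ≠ 0) → h z = f z * g z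

/-- Complete separability: `V(n₁, …, n_d) = V₁(n₁) + ⋯ + V_d(n_d)`. -/
def IsCompletelySeparable {d : ℕ} (V : (Fin d → ℤ) → ℝ) : Prop :=
  ∃ Vi : Fin d → (ℤ → ℝ), ∀ n : Fin d → ℤ, V n = ∑ j, Vi j (n j)

/-! ### Roots of unity and characters -/

lemma rho_eq_pow (q : ℕ+) (m : ℕ) :
    rho q m = Complex.exp (2 * Real.pi * Complex.I / ((q : ℕ) : ℂ)) ^ m := by
  rw [rho, ← Complex.exp_nat_mul]
  ring_nf

lemma isPrimitiveRoot_exp_pnat (q : ℕ+) :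
    IsPrimitiveRoot (Complex.exp (2 * Real.pi * Complex.I / ((q : ℕ) : ℂ))) (q : ℕ) :=
  Complex.isPrimitiveRoot_exp _ q.pos.ne'

lemma rho_ne_zero (q : ℕ+) (m : ℕ) : rho q m ≠ 0 := Complex.exp_ne_zero _

lemma rho_zero (q : ℕ+) : rho q 0 = 1 := by simp [rho]

lemma rho_pow_self (q : ℕ+) (m : ℕ) : rho q m ^ (q : ℕ) = 1 := by
  rw [rho_eq_pow, pow_right_comm, (isPrimitiveRoot_exp_pnat q).pow_eq_one, one_pow]

lemma rho_injective (q : ℕ+) : Function.Injective fun m : Fin (q : ℕ) => rho q m := by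
  intro a b h
  simp only [rho_eq_pow] at h
  exact Fin.ext ((isPrimitiveRoot_exp_pnat q).pow_inj a.2 b.2 h)

lemma rho_mul_star (q : ℕ+) (m : ℕ) : rho q m * star (rho q m) = 1 := by
  have h : ‖rho q m‖ = 1 :=
    Complex.norm_eq_one_of_pow_eq_one (rho_pow_self q m) q.pos.ne'
  change rho q m * (starRingEnd ℂ) (rho q m) = 1
  rw [Complex.mul_conj, Complex.normSq_eq_norm_sq, h]
  simp

lemma star_rho (q : ℕ+) (m : ℕ) : star (rho q m) = (rho q m)⁻¹ :=
  eq_inv_of_mul_eq_one_right (rho_mul_star q m)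

lemma eq_one_of_coprime_pow {x : ℂ} {a b : ℕ} (hab : a.Coprime b) (ha : x ^ a = 1)
    (hb : x ^ b = 1) : x = 1 := by
  have := pow_gcd_eq_one.2 ⟨ha, hb⟩
  rwa [hab.gcd_eq_one, pow_one] at this

lemma sum_pow_eq_zero (q : ℕ+) {x : ℂ} (hx : x ^ (q : ℕ) = 1) (h1 : x ≠ 1) :
    ∑ i : Fin (q : ℕ), x ^ (i : ℕ) = 0 := by
  rw [Fin.sum_univ_eq_sum_range (fun i => x ^ i), geom_sum_eq h1, hx, sub_self, zero_div]

lemma sum_box_prod {d : ℕ} (q : Fin d → ℕ+) (f : ∀ j, Fin (q j : ℕ) → ℂ) :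
    ∑ p : (∀ j, Fin (q j : ℕ)), ∏ j, f j (p j) = ∏ j, ∑ i, f j i := by
  rw [Finset.prod_univ_sum, Fintype.piFinset_univ]

/-- The point of `ℤ^d` given by an element of the fundamental domain. -/
def boxPt {d : ℕ} {q : Fin d → ℕ+} (p : ∀ j, Fin (q j : ℕ)) : Fin d → ℤ :=
  fun j => ((p j : ℕ) : ℤ)

/-- The matrix of characters on the fundamental domain. -/
def charMat {d : ℕ} (q : Fin d → ℕ+) :
    Matrix (∀ j, Fin (q j : ℕ)) (∀ j, Fin (q j : ℕ)) ℂ :=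
  fun p m => ∏ j, rho (q j) (m j) ^ (p j : ℕ)

/-- The inverse of the matrix of characters. -/
def charInv {d : ℕ} (q : Fin d → ℕ+) :
    Matrix (∀ j, Fin (q j : ℕ)) (∀ j, Fin (q j : ℕ)) ℂ :=
  fun m p => (∏ j, ((q j : ℕ) : ℂ))⁻¹ * ∏ j, (rho (q j) (m j))⁻¹ ^ (p j : ℕ)

lemma charInv_mul_charMat {d : ℕ} (q : Fin d → ℕ+) : charInv q * charMat q = 1 := by
  ext m m'
  have h : (charInv q * charMat q) m m' = (∏ j, ((q j : ℕ) : ℂ))⁻¹ *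
      ∏ j, ∑ i : Fin (q j : ℕ), (rho (q j) (m' j) / rho (q j) (m j)) ^ (i : ℕ) := by
    rw [Matrix.mul_apply, ← sum_box_prod, Finset.mul_sum]
    refine Finset.sum_congr rfl fun p _ => ?_
    rw [charInv, charMat, mul_assoc, ← Finset.prod_mul_distrib]
    congr 1
    refine Finset.prod_congr rfl fun j _ => ?_
    rw [← mul_pow, div_eq_inv_mul]
  rw [h]
  by_cases hm : m = m'
  · subst hm
    rw [Matrix.one_apply_eq]
    have : ∀ j, ∑ i : Fin (q j : ℕ), (rho (q j) (m j) / rho (q j) (m j)) ^ (i : ℕ)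
        = ((q j : ℕ) : ℂ) := fun j => by simp [div_self (rho_ne_zero _ _)]
    simp only [this]
    exact inv_mul_cancel₀ (Finset.prod_ne_zero_iff.2 fun j _ => by simp)
  · rw [Matrix.one_apply_ne hm]
    obtain ⟨j, hj⟩ := Function.ne_iff.1 hm
    refine mul_eq_zero_of_right _ (Finset.prod_eq_zero (Finset.mem_univ j) ?_)
    refine sum_pow_eq_zero _ ?_ ?_
    · rw [div_pow, rho_pow_self, rho_pow_self, div_one]
    · intro h1
      rw [div_eq_one_iff_eq (rho_ne_zero _ _)] at h1
      exact hj (rho_injective _ h1).symm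

lemma charMat_mul_charInv {d : ℕ} (q : Fin d → ℕ+) : charMat q * charInv q = 1 :=
  mul_eq_one_comm.1 (charInv_mul_charMat q)

/-- Multiplication by `V` in the basis of characters. -/
def potMat {d : ℕ} (q : Fin d → ℕ+) (V : (Fin d → ℤ) → ℂ) :
    Matrix (∀ j, Fin (q j : ℕ)) (∀ j, Fin (q j : ℕ)) ℂ :=
  charInv q * (Matrix.diagonal (fun p => V (boxPt p)) * charMat q)

lemma charMat_mul_potMat {d : ℕ} (q : Fin d → ℕ+) (V : (Fin d → ℤ) → ℂ) :
    charMat q * potMat q V = Matrix.diagonal (fun p => V (boxPt p)) * charMat q := by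
  rw [potMat, ← Matrix.mul_assoc, charMat_mul_charInv, Matrix.one_mul]

lemma potMat_apply {d : ℕ} (q : Fin d → ℕ+) (V : (Fin d → ℤ) → ℂ)
    (m m' : ∀ j, Fin (q j : ℕ)) :
    potMat q V m m' = (∏ j, ((q j : ℕ) : ℂ))⁻¹ * ∑ p : (∀ j, Fin (q j : ℕ)),
      V (boxPt p) * ∏ j, ((rho (q j) (m j))⁻¹ * rho (q j) (m' j)) ^ (p j : ℕ) := by
  rw [potMat, Matrix.mul_apply, Finset.mul_sum]
  refine Finset.sum_congr rfl fun p _ => ?_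
  rw [Matrix.diagonal_mul, charInv, charMat]
  simp only [mul_pow, Finset.prod_mul_distrib]
  ring

lemma potMat_diag {d : ℕ} (q : Fin d → ℕ+) (V : (Fin d → ℤ) → ℂ)
    (m m' : ∀ j, Fin (q j : ℕ)) : potMat q V m m = potMat q V m' m' := by
  simp [potMat_apply, inv_mul_cancel₀ (rho_ne_zero _ _)]

lemma star_potMat {d : ℕ} (q : Fin d → ℕ+) (V : (Fin d → ℤ) → ℝ)
    (m m' : ∀ j, Fin (q j : ℕ)) :
    star (potMat q (fun n => (V n : ℂ)) m m') = potMat q (fun n => (V n : ℂ)) m' m := by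
  simp only [potMat_apply, star_mul', star_sum, star_prod, star_pow, star_inv₀, star_rho, inv_inv]
  have h : ∀ x : ℝ, star (x : ℂ) = x := Complex.conj_ofReal
  simp [h, mul_comm]

/-! ### Quasi-periodic functions -/

/-- `u (n + q_j e_j) = μ_j u n`. -/
def IsQuasiPeriodic {d : ℕ} (q : Fin d → ℕ+) (μ : Fin d → ℂ) (u : (Fin d → ℤ) → ℂ) : Prop :=
  ∀ (n : Fin d → ℤ) (j : Fin d), u (Function.update n j (n j + ((q j : ℕ) : ℤ))) = μ j * u n

lemma IsQuasiPeriodic.add_mul {d : ℕ} {q : Fin d → ℕ+} {μ : Fin d → ℂ} (hμ : ∀ j, μ j ≠ 0)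
    {u : (Fin d → ℤ) → ℂ} (hu : IsQuasiPeriodic q μ u) (n : Fin d → ℤ) (j : Fin d) (a : ℤ) :
    u (Function.update n j (n j + (q j : ℕ) * a)) = μ j ^ a * u n := by
  induction a with
  | zero => simp
  | succ a ih =>
    have := hu (Function.update n j (n j + (q j : ℕ) * a)) j
    rw [Function.update_idem, Function.update_self, ih] at this
    have e : n j + ((q j : ℕ) : ℤ) * (a + 1) = n j + (q j : ℕ) * a + (q j : ℕ) := by ring
    rw [e, this, zpow_add_one₀ (hμ j)]
    ring
  | pred a ih =>
    have := hu (Function.update n j (n j + (q j : ℕ) * (-a - 1))) j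
    rw [Function.update_idem, Function.update_self] at this
    have e : n j + ((q j : ℕ) : ℤ) * (-a - 1) + ((q j : ℕ) : ℤ) = n j + (q j : ℕ) * (-a) := by ring
    rw [e, ih] at this
    rw [zpow_sub_one₀ (hμ j), mul_right_comm, this]
    field_simp [hμ j]

lemma IsQuasiPeriodic.eq_zero {d : ℕ} {q : Fin d → ℕ+} {μ : Fin d → ℂ} (hμ : ∀ j, μ j ≠ 0)
    {u : (Fin d → ℤ) → ℂ} (hu : IsQuasiPeriodic q μ u)
    (h0 : ∀ p : (∀ j, Fin (q j : ℕ)), u (boxPt p) = 0) : u = 0 := by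
  have key : ∀ s : Finset (Fin d), ∀ n : Fin d → ℤ,
      (∀ j, j ∉ s → 0 ≤ n j ∧ n j < (q j : ℕ)) → u n = 0 := by
    intro s
    induction s using Finset.induction_on with
    | empty =>
      intro n hn
      have hn' := fun j => hn j (Finset.notMem_empty j)
      have : n = boxPt (q := q) (fun j => ⟨(n j).toNat, by have := hn' j; omega⟩) := by
        funext j
        have := hn' j
        simp only [boxPt]
        omega
      rw [this, h0]
    | insert i s hi ih =>
      intro n hn
      have h1 := hu.add_mul hμ (Function.update n i (n i % (q i : ℕ))) i (n i / (q i : ℕ))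
      rw [Function.update_idem, Function.update_self, Int.emod_add_mul_ediv,
        Function.update_eq_self] at h1
      rw [h1, ih, mul_zero]
      intro j hj
      have hq : (0 : ℤ) < (q i : ℕ) := by exact_mod_cast (q i).pos
      by_cases hji : j = i
      · subst hji
        rw [Function.update_self]
        exact ⟨Int.emod_nonneg _ hq.ne', Int.emod_lt_of_pos _ hq⟩
      · rw [Function.update_of_ne hji]
        exact hn j (by simp [hji, hj])
  funext n
  exact key Finset.univ n (by simp)

lemma IsQuasiPeriodic.sub {d : ℕ} {q : Fin d → ℕ+} {μ : Fin d → ℂ}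
    {u v : (Fin d → ℤ) → ℂ} (hu : IsQuasiPeriodic q μ u) (hv : IsQuasiPeriodic q μ v) :
    IsQuasiPeriodic q μ (fun n => u n - v n) := fun n j => by
  simp only [hu n j, hv n j, mul_sub]

lemma IsQuasiPeriodic.ext {d : ℕ} {q : Fin d → ℕ+} {μ : Fin d → ℂ} (hμ : ∀ j, μ j ≠ 0)
    {u v : (Fin d → ℤ) → ℂ} (hu : IsQuasiPeriodic q μ u) (hv : IsQuasiPeriodic q μ v)
    (h : ∀ p : (∀ j, Fin (q j : ℕ)), u (boxPt p) = v (boxPt p)) : u = v := by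
  have := (hu.sub hv).eq_zero hμ fun p => sub_eq_zero.2 (h p)
  funext n
  exact sub_eq_zero.1 (congrFun this n)

/-- The Floquet function with coefficients `c` with respect to the Bloch waves
`n ↦ ∏ j, (ρ_{m_j} z_j) ^ n_j`. -/
def synth {d : ℕ} (q : Fin d → ℕ+) (z : Fin d → ℂ) (c : (∀ j, Fin (q j : ℕ)) → ℂ)
    (n : Fin d → ℤ) : ℂ :=
  ∑ m, c m * ∏ j, (rho (q j) (m j) * z j) ^ n j

section Synth

variable {d : ℕ} {q : Fin d → ℕ+} {z : Fin d → ℂ}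

lemma prod_zpow_update {x : Fin d → ℂ} (hx : ∀ j, x j ≠ 0) (n : Fin d → ℤ) (j : Fin d) (a : ℤ) :
    ∏ i, x i ^ (Function.update n j (n j + a) i) = x j ^ a * ∏ i, x i ^ n i := by
  have h : ∀ i, x i ^ (Function.update n j (n j + a) i)
      = (if i = j then x j ^ a else 1) * x i ^ n i := by
    intro i
    by_cases hij : i = j
    · subst hij
      rw [Function.update_self, if_pos rfl, zpow_add₀ (hx i), mul_comm]
    · rw [Function.update_of_ne hij, if_neg hij, one_mul]
  simp only [h, Finset.prod_mul_distrib, Finset.prod_ite_eq', Finset.mem_univ, if_true]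

lemma synth_isQuasiPeriodic (hz : ∀ j, z j ≠ 0) (c : (∀ j, Fin (q j : ℕ)) → ℂ) :
    IsQuasiPeriodic q (fun j => z j ^ (q j : ℕ)) (synth q z c) := by
  intro n j
  rw [synth, synth, Finset.mul_sum]
  refine Finset.sum_congr rfl fun m _ => ?_
  rw [prod_zpow_update fun i => mul_ne_zero (rho_ne_zero _ _) (hz i), zpow_natCast, mul_pow,
    rho_pow_self]
  ring

lemma synth_boxPt (c : (∀ j, Fin (q j : ℕ)) → ℂ) (p : ∀ j, Fin (q j : ℕ)) :
    synth q z c (boxPt p) = (∏ j, z j ^ (p j : ℕ)) * (charMat q).mulVec c p := by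
  rw [synth, Matrix.mulVec, dotProduct, Finset.mul_sum]
  refine Finset.sum_congr rfl fun m _ => ?_
  simp only [boxPt, zpow_natCast, mul_pow, Finset.prod_mul_distrib, charMat]
  ring

lemma prod_pow_box_ne_zero (hz : ∀ j, z j ≠ 0) (p : ∀ j, Fin (q j : ℕ)) :
    ∏ j, z j ^ (p j : ℕ) ≠ 0 :=
  Finset.prod_ne_zero_iff.2 fun j _ => pow_ne_zero _ (hz j)

lemma synth_eq_zero_iff (hz : ∀ j, z j ≠ 0) (c : (∀ j, Fin (q j : ℕ)) → ℂ) :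
    synth q z c = 0 ↔ c = 0 := by
  constructor
  · intro h
    have h1 : (charMat q).mulVec c = 0 := by
      funext p
      have := congrFun h (boxPt p)
      rw [synth_boxPt] at this
      exact (mul_eq_zero.1 this).resolve_left (prod_pow_box_ne_zero hz p)
    have h2 := congrArg (charInv q).mulVec h1
    rwa [Matrix.mulVec_mulVec, charInv_mul_charMat, Matrix.one_mulVec, Matrix.mulVec_zero] at h2
  · rintro rfl
    funext n
    simp [synth]

lemma IsQuasiPeriodic.exists_synth (hz : ∀ j, z j ≠ 0) {u : (Fin d → ℤ) → ℂ}
    (hu : IsQuasiPeriodic q (fun j => z j ^ (q j : ℕ)) u) : ∃ c, u = synth q z c := by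
  refine ⟨(charInv q).mulVec fun p => (∏ j, z j ^ (p j : ℕ))⁻¹ * u (boxPt p), ?_⟩
  refine hu.ext (fun j => pow_ne_zero _ (hz j)) (synth_isQuasiPeriodic hz _) fun p => ?_
  rw [synth_boxPt, Matrix.mulVec_mulVec, charMat_mul_charInv, Matrix.one_mulVec, ← mul_assoc,
    mul_inv_cancel₀ (prod_pow_box_ne_zero hz p), one_mul]

lemma neg_discLap_synth (hz : ∀ j, z j ≠ 0) (c : (∀ j, Fin (q j : ℕ)) → ℂ) (n : Fin d → ℤ) :
    -(discLap (synth q z c) n) = synth q z ((Amat q z).mulVec c) n := by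
  have h : ∀ m : (∀ j, Fin (q j : ℕ)), ∀ i, rho (q i) (m i) * z i ≠ 0 :=
    fun m i => mul_ne_zero (rho_ne_zero _ _) (hz i)
  simp only [discLap, synth, sub_eq_add_neg, prod_zpow_update (h _), zpow_one, zpow_neg,
    ← Finset.sum_add_distrib]
  rw [Finset.sum_comm, ← Finset.sum_neg_distrib]
  refine Finset.sum_congr rfl fun m _ => ?_
  rw [Amat, Matrix.mulVec_diagonal, neg_mul, neg_mul, Finset.sum_mul, Finset.sum_mul]
  congr 1
  refine Finset.sum_congr rfl fun j _ => ?_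
  ring

lemma mul_synth {V : (Fin d → ℤ) → ℂ} (hV : IsPeriodic q V) (hz : ∀ j, z j ≠ 0)
    (c : (∀ j, Fin (q j : ℕ)) → ℂ) :
    (fun n => V n * synth q z c n) = synth q z ((potMat q V).mulVec c) := by
  refine IsQuasiPeriodic.ext (fun j => pow_ne_zero _ (hz j)) (fun n j => ?_)
    (synth_isQuasiPeriodic hz _) fun p => ?_
  · rw [hV, synth_isQuasiPeriodic hz]
    ring
  · rw [synth_boxPt, synth_boxPt, Matrix.mulVec_mulVec, charMat_mul_potMat,
      ← Matrix.mulVec_mulVec, Matrix.mulVec_diagonal]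
    ring

lemma synth_add (c c' : (∀ j, Fin (q j : ℕ)) → ℂ) (n : Fin d → ℤ) :
    synth q z (c + c') n = synth q z c n + synth q z c' n := by
  simp [synth, add_mul, Finset.sum_add_distrib]

lemma synth_smul (a : ℂ) (c : (∀ j, Fin (q j : ℕ)) → ℂ) (n : Fin d → ℤ) :
    synth q z (a • c) n = a * synth q z c n := by
  simp [synth, Finset.mul_sum, mul_assoc]

end Synth

/-- The Floquet matrix at energy `lam`, in the basis of characters. -/
def floquetMat {d : ℕ} (q : Fin d → ℕ+) (V : (Fin d → ℤ) → ℂ) (lam : ℂ) (z : Fin d → ℂ) :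
    Matrix (∀ j, Fin (q j : ℕ)) (∀ j, Fin (q j : ℕ)) ℂ :=
  Amat q z + potMat q V + (-lam) • 1

lemma mem_FermiVariety_iff {d : ℕ} {q : Fin d → ℕ+} {V : (Fin d → ℤ) → ℂ}
    (hV : IsPeriodic q V) (lam : ℂ) {z k : Fin d → ℂ} (hz : ∀ j, z j ≠ 0)
    (hk : ∀ j, Complex.exp (2 * (Real.pi : ℂ) * Complex.I * k j) = z j ^ (q j : ℕ)) :
    k ∈ FermiVariety q V lam ↔ (floquetMat q V lam z).det = 0 := by
  have hS : ∀ c, (∀ n, -(discLap (synth q z c) n) + V n * synth q z c n = lam * synth q z c n) ↔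
      (floquetMat q V lam z).mulVec c = 0 := by
    intro c
    rw [← synth_eq_zero_iff hz, funext_iff]
    refine forall_congr' fun n => ?_
    rw [floquetMat, Matrix.add_mulVec, Matrix.add_mulVec, Matrix.smul_mulVec, Matrix.one_mulVec,
      synth_add, synth_add, synth_smul, neg_discLap_synth hz,
      show V n * synth q z c n = _ from congrFun (mul_synth hV hz c) n, Pi.zero_apply, neg_mul,
      ← sub_eq_add_neg, sub_eq_zero]
  rw [← Matrix.exists_mulVec_eq_zero_iff]
  simp only [FermiVariety, Set.mem_ofPred_eq, hk]
  constructor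
  · rintro ⟨u, hu0, hu, hq⟩
    obtain ⟨c, rfl⟩ := IsQuasiPeriodic.exists_synth hz hq
    exact ⟨c, fun h => hu0 ((synth_eq_zero_iff hz c).2 h), (hS c).1 hu⟩
  · rintro ⟨c, hc0, hc⟩
    exact ⟨synth q z c, fun h => hc0 ((synth_eq_zero_iff hz c).1 h), (hS c).2 hc,
      synth_isQuasiPeriodic hz c⟩

lemma det_floquetMat_eq_zero_of_subset {d : ℕ} {q : Fin d → ℕ+} {V Y : (Fin d → ℤ) → ℂ}
    (hV : IsPeriodic q V) (hY : IsPeriodic q Y) {lam : ℂ}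
    (h : FermiVariety q Y lam ⊆ FermiVariety q V lam) {z : Fin d → ℂ} (hz : ∀ j, z j ≠ 0)
    (h0 : (floquetMat q Y lam z).det = 0) : (floquetMat q V lam z).det = 0 := by
  have hπ : 2 * (Real.pi : ℂ) * Complex.I ≠ 0 := Complex.two_pi_I_ne_zero
  have hk : ∀ j, Complex.exp (2 * (Real.pi : ℂ) * Complex.I *
      ((q j : ℕ) * Complex.log (z j) / (2 * (Real.pi : ℂ) * Complex.I))) = z j ^ (q j : ℕ) := by
    intro j
    rw [mul_div_cancel₀ _ hπ, Complex.exp_nat_mul, Complex.exp_log (hz j)]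
  exact (mem_FermiVariety_iff hV lam hz hk).1 (h ((mem_FermiVariety_iff hY lam hz hk).2 h0))

/-! ### Linear dependence of the leading forms -/

lemma mul_eq_zero_of_three_unimodular {a b : ℂ} {x₁ x₂ x₃ : ℂ}
    (h₁ : x₁ * star x₁ = 1) (h₂ : x₂ * star x₂ = 1) (h₃ : x₃ * star x₃ = 1)
    (h₁₂ : x₁ ≠ x₂) (h₁₃ : x₁ ≠ x₃) (h₂₃ : x₂ ≠ x₃)
    (e₁ : (a + b * x₁) * star (a + b * x₁) = 1) (e₂ : (a + b * x₂) * star (a + b * x₂) = 1)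
    (e₃ : (a + b * x₃) * star (a + b * x₃) = 1) : a = 0 ∨ b = 0 := by
  have quad : ∀ x : ℂ, x * star x = 1 → (a + b * x) * star (a + b * x) = 1 →
      b * star a * x ^ 2 + (a * star a + b * star b - 1) * x + a * star b = 0 := by
    intro x hx hy
    rw [star_add, star_mul'] at hy
    linear_combination x * hy - (a * star b + b * star b * x) * hx
  have dif : ∀ x y : ℂ, x ≠ y → x * star x = 1 → y * star y = 1 →
      (a + b * x) * star (a + b * x) = 1 → (a + b * y) * star (a + b * y) = 1 →
      b * star a * (x + y) + (a * star a + b * star b - 1) = 0 := by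
    intro x y hxy hx hy ex ey
    refine (mul_eq_zero.1 ?_).resolve_left (sub_ne_zero.2 hxy)
    linear_combination quad x hx ex - quad y hy ey
  have h : (x₂ - x₃) * (b * star a) = 0 := by
    linear_combination dif x₁ x₂ h₁₂ h₁ h₂ e₁ e₂ - dif x₁ x₃ h₁₃ h₁ h₃ e₁ e₃
  rcases mul_eq_zero.1 ((mul_eq_zero.1 h).resolve_left (sub_ne_zero.2 h₂₃)) with h | h
  · exact Or.inr h
  · exact Or.inl (star_eq_zero.1 h)

section Forms

variable {d : ℕ} {q : Fin d → ℕ+}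

lemma rho_ne_rho (hq : ∀ i j, i ≠ j → Nat.Coprime (q i) (q j)) (l : ∀ j, Fin (q j : ℕ))
    {i k : Fin d} (hik : i ≠ k) (hi : rho (q i) (l i) ≠ 1) :
    rho (q i) (l i) ≠ rho (q k) (l k) := fun h =>
  hi (eq_one_of_coprime_pow (hq i k hik) (rho_pow_self _ _) (h ▸ rho_pow_self _ _))

lemma exists_three_rho (hd : 3 ≤ d) (hq : ∀ i j, i ≠ j → Nat.Coprime (q i) (q j))
    (l : ∀ j, Fin (q j : ℕ)) {i k : Fin d} (hi : rho (q i) (l i) ≠ 1)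
    (hk : rho (q k) (l k) ≠ 1) : ∃ m, rho (q i) (l i) ≠ rho (q m) (l m) ∧
      rho (q k) (l k) ≠ rho (q m) (l m) := by
  obtain ⟨m, hm⟩ : ∃ m, m ∉ ({i, k} : Finset (Fin d)) := by
    by_contra! h
    have h1 := Finset.card_le_card (fun x _ => h x : (Finset.univ : Finset (Fin d)) ⊆ {i, k})
    have h2 := Finset.card_le_two (a := i) (b := k)
    rw [Finset.card_univ, Fintype.card_fin] at h1
    omega
  simp only [Finset.mem_insert, Finset.mem_singleton, not_or] at hm
  exact ⟨m, rho_ne_rho hq l (Ne.symm hm.1) hi, rho_ne_rho hq l (Ne.symm hm.2) hk⟩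

/-- The linear form `z ↦ ∑ j, ρ_{m_j} z_j`. -/
def leadForm (m : ∀ j, Fin (q j : ℕ)) : Module.Dual ℂ (Fin d → ℂ) :=
  ∑ j, rho (q j) (m j) • LinearMap.proj j

lemma leadForm_apply (m : ∀ j, Fin (q j : ℕ)) (z : Fin d → ℂ) :
    leadForm m z = ∑ j, rho (q j) (m j) * z j := by
  simp [leadForm]

lemma leadForm_single (m : ∀ j, Fin (q j : ℕ)) (j : Fin d) (x : ℂ) :
    leadForm m (Pi.single j x) = rho (q j) (m j) * x := by
  simp [leadForm_apply, Pi.single_apply]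

/-- The zero frequency. -/
def zeroFreq (q : Fin d → ℕ+) : ∀ j, Fin (q j : ℕ) := fun j => ⟨0, (q j).pos⟩

lemma rho_zeroFreq (j : Fin d) : rho (q j) (zeroFreq q j) = 1 := rho_zero _

lemma exists_leadForm_eq {l : ∀ j, Fin (q j : ℕ)} {i k : Fin d}
    (hx : rho (q i) (l i) ≠ rho (q k) (l k)) :
    ∃ w₁ w₂ : Fin d → ℂ, leadForm (zeroFreq q) w₁ = 1 ∧ leadForm l w₁ = 0 ∧
      leadForm (zeroFreq q) w₂ = 0 ∧ leadForm l w₂ = 1 := by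
  have hx' := sub_ne_zero.2 hx
  set D := rho (q i) (l i) - rho (q k) (l k) with hD
  refine ⟨Pi.single i (-rho (q k) (l k) / D) + Pi.single k (rho (q i) (l i) / D),
    Pi.single i (1 / D) + Pi.single k (-1 / D), ?_, ?_, ?_, ?_⟩ <;>
    simp only [map_add, leadForm_single, rho_zeroFreq] <;> field_simp <;> simp only [hD] <;> ring

/-- Two leading forms and a third one are independent if the frequencies are not all on one
coordinate axis. -/
lemma eq_or_eq_of_leadForm_mem_span (hd : 3 ≤ d)
    (hq : ∀ i j, i ≠ j → Nat.Coprime (q i) (q j)) {l : ∀ j, Fin (q j : ℕ)} {i k : Fin d}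
    (hik : i ≠ k) (hi : rho (q i) (l i) ≠ 1) (hk : rho (q k) (l k) ≠ 1)
    {n : ∀ j, Fin (q j : ℕ)}
    (hn : leadForm n ∈ Submodule.span ℂ {leadForm (zeroFreq q), leadForm l}) :
    n = zeroFreq q ∨ n = l := by
  obtain ⟨a, b, hab⟩ := Submodule.mem_span_pair.1 hn
  have e : ∀ j, a + b * rho (q j) (l j) = rho (q j) (n j) := by
    intro j
    have := LinearMap.congr_fun hab (Pi.single j 1)
    simpa [leadForm_single, rho_zeroFreq] using this
  obtain ⟨m, him, hkm⟩ := exists_three_rho hd hq l hi hk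
  have other : ∀ j : Fin d, ∃ j', j ≠ j' := fun j =>
    (em (j = i)).elim (fun h => ⟨k, h ▸ hik⟩) fun h => ⟨i, h⟩
  have hu : ∀ j, (a + b * rho (q j) (l j)) * star (a + b * rho (q j) (l j)) = 1 := fun j => by
    rw [e, rho_mul_star]
  rcases mul_eq_zero_of_three_unimodular (rho_mul_star _ _) (rho_mul_star _ _)
    (rho_mul_star _ _) (rho_ne_rho hq l hik hi) him hkm (hu i) (hu k) (hu m) with rfl | rfl
  · right
    funext j
    obtain ⟨j', hj⟩ := other j
    have hb : ∀ j, b = rho (q j) (n j) / rho (q j) (l j) := fun j => by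
      rw [← e j, zero_add, mul_div_cancel_right₀ _ (rho_ne_zero _ _)]
    have hp : ∀ j, b ^ (q j : ℕ) = 1 := fun j => by
      rw [hb j, div_pow, rho_pow_self, rho_pow_self, div_one]
    have hb1 := eq_one_of_coprime_pow (hq j j' hj) (hp j) (hp j')
    refine rho_injective (q j) ?_
    simp only [← e j, hb1, zero_add, one_mul]
  · left
    funext j
    obtain ⟨j', hj⟩ := other j
    have hp : ∀ j, a ^ (q j : ℕ) = 1 := fun j => by
      have := e j
      rw [zero_mul, add_zero] at this
      rw [this, rho_pow_self]
    have ha1 := eq_one_of_coprime_pow (hq j j' hj) (hp j) (hp j')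
    refine rho_injective (q j) ?_
    simp only [← e j, ha1, zero_mul, add_zero, rho_zeroFreq]

lemma proj_notMem_span_leadForm (hd : 3 ≤ d)
    (hq : ∀ i j, i ≠ j → Nat.Coprime (q i) (q j)) {l : ∀ j, Fin (q j : ℕ)} {i k : Fin d}
    (hik : i ≠ k) (hi : rho (q i) (l i) ≠ 1) (hk : rho (q k) (l k) ≠ 1) (j : Fin d) :
    (LinearMap.proj j : Module.Dual ℂ (Fin d → ℂ)) ∉
      Submodule.span ℂ {leadForm (zeroFreq q), leadForm l} := by
  intro hn
  obtain ⟨a, b, hab⟩ := Submodule.mem_span_pair.1 hn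
  have e : ∀ j', a + b * rho (q j') (l j') = if j' = j then 1 else 0 := by
    intro j'
    have := LinearMap.congr_fun hab (Pi.single j' 1)
    simpa [leadForm_single, rho_zeroFreq, Pi.single_apply, eq_comm] using this
  obtain ⟨m, him, hkm⟩ := exists_three_rho hd hq l hi hk
  have hxy := rho_ne_rho hq l hik hi
  have contra : ∀ r s, rho (q r) (l r) ≠ rho (q s) (l s) → r ≠ j → s ≠ j → False := by
    intro r s hrs hr hs
    have er := e r
    have es := e s
    rw [if_neg hr] at er
    rw [if_neg hs] at es
    have hb : b = 0 := by
      refine (mul_eq_zero.1 ?_).resolve_left (sub_ne_zero.2 hrs)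
      linear_combination er - es
    have ha : a = 0 := by simpa [hb] using er
    simpa [ha, hb] using e j
  have hkm' : k ≠ m := fun h => hkm (h ▸ rfl)
  have him' : i ≠ m := fun h => him (h ▸ rfl)
  by_cases h1 : i = j
  · exact contra k m hkm (h1 ▸ hik.symm) (h1 ▸ him'.symm)
  · by_cases h2 : k = j
    · exact contra i m him h1 (h2 ▸ hkm'.symm)
    · exact contra i k hxy h1 h2

lemma exists_generic {E : Type*} [AddCommGroup E] [Module ℂ E] (f g : Module.Dual ℂ E)
    {ι : Type*} [Finite ι] (h : ι → Module.Dual ℂ E)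
    (hh : ∀ i, h i ∉ Submodule.span ℂ {f, g}) :
    ∃ z, f z = 0 ∧ g z = 0 ∧ ∀ i, h i z ≠ 0 := by
  let K : Submodule ℂ E := LinearMap.ker f ⊓ LinearMap.ker g
  by_contra! H
  have hcov : ⋃ i, (LinearMap.ker ((h i).comp K.subtype) : Set K) = Set.univ := by
    refine Set.eq_univ_of_forall fun z => ?_
    obtain ⟨i, hi⟩ := H z z.2.1 z.2.2
    exact Set.mem_iUnion.2 ⟨i, hi⟩
  obtain ⟨i, hi⟩ := Subspace.exists_eq_top_of_iUnion_eq_univ hcov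
  refine hh i ?_
  have hfg : Set.range ![f, g] = {f, g} := by simp [Matrix.range_cons, Set.pair_comm]
  rw [← hfg]
  refine mem_span_of_iInf_ker_le_ker fun z hz => ?_
  simp only [Submodule.mem_iInf, Fin.forall_fin_two] at hz
  have : (⟨z, hz.1, hz.2⟩ : K) ∈ LinearMap.ker ((h i).comp K.subtype) := hi ▸ Submodule.mem_top
  exact this

end Forms

/-! ### Persistence of zeros -/

open Topology in
lemma eventually_exists_zero {F : ℂ × ℂ → ℂ} {U : Set (ℂ × ℂ)} (hU : IsOpen U)
    (hF : DifferentiableOn ℂ F U) (h0U : ∀ s, ((0 : ℂ), s) ∈ U) (h00 : F (0, 0) = 0)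
    (h0 : ∀ s, s ≠ 0 → F (0, s) ≠ 0) {r : ℝ} (hr : 0 < r) :
    ∀ᶠ t in 𝓝 (0 : ℂ), ∃ s ∈ Metric.closedBall (0 : ℂ) r, (t, s) ∈ U ∧ F (t, s) = 0 := by
  have hUn : ∀ s : ℂ, U ∈ 𝓝 ((0 : ℂ), s) := fun s => hU.mem_nhds (h0U s)
  have hcont : ∀ s : ℂ, ContinuousAt F (0, s) := fun s => hF.continuousOn.continuousAt (hUn s)
  have hslice : ∀ t : ℂ, Continuous fun s : ℂ => (t, s) := fun t => by fun_prop
  obtain ⟨ε, hε, hlow⟩ : ∃ ε > 0, ∀ s ∈ Metric.sphere (0 : ℂ) r, ε < ‖F (0, s)‖ := by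
    have hc : ContinuousOn (fun s => ‖F (0, s)‖) (Metric.sphere (0 : ℂ) r) := by
      intro s _
      exact (ContinuousAt.comp (f := fun s : ℂ => ((0 : ℂ), s)) (hcont s)
        (hslice 0).continuousAt).norm.continuousWithinAt
    obtain ⟨s₀, hs₀, hmin⟩ := (isCompact_sphere (0 : ℂ) r).exists_isMinOn
      (NormedSpace.sphere_nonempty.2 hr.le) hc
    have hpos : 0 < ‖F (0, s₀)‖ := norm_pos_iff.2 (h0 s₀ fun h => by
      rw [h, mem_sphere_zero_iff_norm, norm_zero] at hs₀
      exact hr.ne hs₀)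
    exact ⟨‖F (0, s₀)‖ / 2, half_pos hpos, fun s hs =>
      (half_lt_self hpos).trans_le (hmin hs)⟩
  have ev1 : ∀ᶠ t in 𝓝 (0 : ℂ), ∀ s ∈ Metric.closedBall (0 : ℂ) r, (t, s) ∈ U :=
    (isCompact_closedBall (0 : ℂ) r).eventually_forall_of_forall_eventually
      (P := fun t s => (t, s) ∈ U) fun s _ => hUn s
  have ev2 : ∀ᶠ t in 𝓝 (0 : ℂ), ∀ s ∈ Metric.sphere (0 : ℂ) r, ε < ‖F (t, s) - F (t, 0)‖ := by
    refine (isCompact_sphere (0 : ℂ) r).eventually_forall_of_forall_eventually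
      (P := fun t s => ε < ‖F (t, s) - F (t, 0)‖) fun s hs => ?_
    have hc : ContinuousAt (fun z : ℂ × ℂ => ‖F z - F (z.1, 0)‖) (0, s) :=
      ((hcont s).sub (ContinuousAt.comp (f := fun z : ℂ × ℂ => (z.1, (0 : ℂ))) (hcont 0)
        (by fun_prop))).norm
    refine hc.eventually_const_lt ?_
    simpa [h00] using hlow s hs
  have ev3 : ∀ᶠ t in 𝓝 (0 : ℂ), ‖F (t, 0)‖ < ε / 2 := by
    have hc : ContinuousAt (fun t : ℂ => ‖F (t, 0)‖) 0 :=
      (ContinuousAt.comp (f := fun t : ℂ => (t, (0 : ℂ))) (hcont 0) (by fun_prop)).norm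
    refine hc.eventually_lt_const ?_
    simpa [h00] using half_pos hε
  filter_upwards [ev1, ev2, ev3] with t h1 h2 h3
  have hd : DiffContOnCl ℂ (fun s => F (t, s)) (Metric.ball 0 r) := by
    refine DifferentiableOn.diffContOnCl fun s hs => ?_
    rw [closure_ball _ hr.ne'] at hs
    have hdiff : DifferentiableAt ℂ F (t, s) := hF.differentiableAt (hU.mem_nhds (h1 s hs))
    exact (DifferentiableAt.comp (f := fun s : ℂ => (t, s)) s hdiff
      (by fun_prop)).differentiableWithinAt
  have hne : ∃ᶠ s in 𝓝 (0 : ℂ), F (t, s) ≠ F (t, 0) := by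
    intro hev
    have han : AnalyticOnNhd ℂ (fun s => F (t, s)) (Metric.closedBall 0 r) := by
      have hopen : IsOpen {s : ℂ | (t, s) ∈ U} := hU.preimage (hslice t)
      have hdo : DifferentiableOn ℂ (fun s => F (t, s)) {s : ℂ | (t, s) ∈ U} :=
        hF.comp (by fun_prop) fun s hs => hs
      exact (hdo.analyticOnNhd hopen).mono h1
    obtain ⟨s, hs⟩ : (Metric.sphere (0 : ℂ) r).Nonempty := NormedSpace.sphere_nonempty.2 hr.le
    have heq : F (t, s) = F (t, 0) :=
      han.eqOn_of_preconnected_of_eventuallyEq analyticOnNhd_const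
        (convex_closedBall _ _).isPreconnected (Metric.mem_closedBall_self hr.le)
        (hev.mono fun _ h => not_not.1 h) (Metric.sphere_subset_closedBall hs)
    have := h2 s hs
    rw [heq, sub_self, norm_zero] at this
    exact hε.not_gt this
  have himg := hd.ball_subset_image_closedBall hr (fun s hs => (h2 s hs).le) hne
  obtain ⟨s, hs, hs0⟩ := himg (show (0 : ℂ) ∈ _ by simpa using h3)
  exact ⟨s, hs, h1 s hs, hs0⟩

open Topology in
lemma eq_zero_of_zeros_subset {F G : ℂ × ℂ → ℂ} {U : Set (ℂ × ℂ)} (hU : IsOpen U)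
    (hF : DifferentiableOn ℂ F U) (hG : ContinuousOn G U) (h0U : ∀ s, ((0 : ℂ), s) ∈ U)
    (h00 : F (0, 0) = 0) (h0 : ∀ s, s ≠ 0 → F (0, s) ≠ 0)
    (hFG : ∀ t s, t ≠ 0 → (t, s) ∈ U → F (t, s) = 0 → G (t, s) = 0) : G (0, 0) = 0 := by
  by_contra hne
  have hc : ContinuousAt G (0, 0) := hG.continuousAt (hU.mem_nhds (h0U 0))
  obtain ⟨δ, hδ, hball⟩ := Metric.eventually_nhds_iff_ball.1 (hc.eventually_ne hne)
  have hev := (eventually_exists_zero hU hF h0U h00 h0 (half_pos hδ)).and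
    (Metric.ball_mem_nhds (0 : ℂ) hδ)
  obtain ⟨t, ⟨⟨s, hs, hsU, hs0⟩, htδ⟩, ht0⟩ :=
    ((hev.filter_mono nhdsWithin_le_nhds).and
      (self_mem_nhdsWithin (a := (0 : ℂ)) (s := {(0 : ℂ)}ᶜ))).exists
  refine hball (t, s) ?_ (hFG t s ht0 hsU hs0)
  rw [← ball_prod_same]
  exact ⟨htδ, Metric.closedBall_subset_ball (half_lt_self hδ) hs⟩

/-! ### Asymptotics of the Floquet matrix along a ray -/

section Asymptotics

variable {d : ℕ} {q : Fin d → ℕ+}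

/-- The Floquet matrix at the point `z₀ / t + w`, where all rows but those indexed by `0` and `l`
are multiplied by `t`, extended to `t = 0`. -/
def asymMat (V : (Fin d → ℤ) → ℂ) (lam : ℂ) (l : ∀ j, Fin (q j : ℕ)) (z₀ : Fin d → ℂ) (t : ℂ)
    (w : Fin d → ℂ) : Matrix (∀ j, Fin (q j : ℕ)) (∀ j, Fin (q j : ℕ)) ℂ :=
  Matrix.diagonal (fun n => if n = zeroFreq q ∨ n = l then
      -(leadForm n w + ∑ j, (rho (q j) (n j))⁻¹ * (t / (z₀ j + t * w j)))
    else -(leadForm n z₀ + t * (leadForm n w + ∑ j, (rho (q j) (n j))⁻¹ * (t / (z₀ j + t * w j)))))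
  + Matrix.diagonal (fun n => if n = zeroFreq q ∨ n = l then 1 else t) *
    (potMat q V + (-lam) • 1)

lemma asymMat_eq (V : (Fin d → ℤ) → ℂ) (lam : ℂ) {l : ∀ j, Fin (q j : ℕ)} {z₀ : Fin d → ℂ}
    (h0 : leadForm (zeroFreq q) z₀ = 0) (hl : leadForm l z₀ = 0) {t : ℂ} (ht : t ≠ 0)
    (w : Fin d → ℂ) :
    asymMat V lam l z₀ t w = Matrix.diagonal (fun n => if n = zeroFreq q ∨ n = l then 1 else t) *
      floquetMat q V lam (t⁻¹ • z₀ + w) := by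
  rw [asymMat, floquetMat, add_assoc (Amat _ _), Matrix.mul_add _ (Amat _ _), Amat, Matrix.diagonal_mul_diagonal]
  congr 2
  funext n
  have hA : ∑ j, (rho (q j) (n j) * (t⁻¹ • z₀ + w) j + (rho (q j) (n j) * (t⁻¹ • z₀ + w) j)⁻¹) =
      t⁻¹ * leadForm n z₀ +
      (leadForm n w + ∑ j, (rho (q j) (n j))⁻¹ * (t / (z₀ j + t * w j))) := by
    have hinv : ∀ j, (rho (q j) (n j) * (t⁻¹ • z₀ + w) j)⁻¹ =
        (rho (q j) (n j))⁻¹ * (t / (z₀ j + t * w j)) := by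
      intro j
      rw [mul_inv]
      congr 1
      rw [← inv_div]
      congr 1
      simp only [Pi.add_apply, Pi.smul_apply, smul_eq_mul]
      field_simp
    simp only [Finset.sum_add_distrib, hinv]
    rw [← leadForm_apply, map_add, map_smul, smul_eq_mul, add_assoc]
  rw [hA]
  split_ifs with hn
  · have : leadForm n z₀ = 0 := by rcases hn with rfl | rfl <;> assumption
    rw [this]
    ring
  · field_simp

lemma det_asymMat_eq_zero_iff (V : (Fin d → ℤ) → ℂ) (lam : ℂ) {l : ∀ j, Fin (q j : ℕ)}
    {z₀ : Fin d → ℂ} (h0 : leadForm (zeroFreq q) z₀ = 0) (hl : leadForm l z₀ = 0) {t : ℂ}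
    (ht : t ≠ 0) (w : Fin d → ℂ) :
    (asymMat V lam l z₀ t w).det = 0 ↔ (floquetMat q V lam (t⁻¹ • z₀ + w)).det = 0 := by
  rw [asymMat_eq V lam h0 hl ht, Matrix.det_mul, Matrix.det_diagonal, mul_eq_zero,
    or_iff_right]
  refine Finset.prod_ne_zero_iff.2 fun n _ => ?_
  split_ifs
  exacts [one_ne_zero, ht]

lemma differentiableOn_det_asymMat (V : (Fin d → ℤ) → ℂ) (lam : ℂ) (l : ∀ j, Fin (q j : ℕ))
    (z₀ : Fin d → ℂ) {w : ℂ → Fin d → ℂ} (hw : Differentiable ℂ w) :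
    DifferentiableOn ℂ (fun x : ℂ × ℂ => (asymMat V lam l z₀ x.1 (w x.2)).det)
      {x | ∀ j, z₀ j + x.1 * w x.2 j ≠ 0} := by
  intro x hx
  refine DifferentiableAt.differentiableWithinAt ?_
  have hwj : ∀ j, DifferentiableAt ℂ (fun x : ℂ × ℂ => w x.2 j) x := fun j =>
    ((differentiable_pi.1 hw j).comp differentiable_snd).differentiableAt
  have hlead : ∀ n : (∀ j, Fin (q j : ℕ)),
      DifferentiableAt ℂ (fun x : ℂ × ℂ => leadForm n (w x.2)) x := fun n => by
    simp only [leadForm_apply]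
    fun_prop
  have hg : ∀ j, DifferentiableAt ℂ (fun x : ℂ × ℂ => x.1 / (z₀ j + x.1 * w x.2 j)) x :=
    fun j => by
    have := hx j
    fun_prop (disch := assumption)
  have hentry : ∀ n m, DifferentiableAt ℂ (fun x : ℂ × ℂ => asymMat V lam l z₀ x.1 (w x.2) n m) x
      := fun n m => by
    simp only [asymMat, Matrix.add_apply, Matrix.diagonal_mul, Matrix.diagonal_apply]
    refine DifferentiableAt.fun_add ?_ ?_ <;> split_ifs <;> fun_prop
  simp only [Matrix.det_apply]
  refine DifferentiableAt.fun_sum fun σ _ => DifferentiableAt.fun_const_smul ?_ _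
  fun_prop

lemma asymMat_zero_mulVec (V : (Fin d → ℤ) → ℂ) (lam : ℂ) (l : ∀ j, Fin (q j : ℕ))
    (z₀ w : Fin d → ℂ) (v : (∀ j, Fin (q j : ℕ)) → ℂ) (n : ∀ j, Fin (q j : ℕ)) :
    (asymMat V lam l z₀ 0 w).mulVec v n = if n = zeroFreq q ∨ n = l then
      (-leadForm n w - lam) * v n + (potMat q V).mulVec v n else -leadForm n z₀ * v n := by
  rw [asymMat, Matrix.add_mulVec, Pi.add_apply, Matrix.mulVec_diagonal, ← Matrix.mulVec_mulVec,
    Matrix.mulVec_diagonal, Matrix.add_mulVec, Matrix.smul_mulVec, Matrix.one_mulVec]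
  split_ifs <;> simp
  ring

/-- The limit of the rescaled determinant is, up to a constant, a `2 × 2` determinant. -/
lemma det_asymMat_zero_iff (V : (Fin d → ℤ) → ℂ) (lam : ℂ) {l : ∀ j, Fin (q j : ℕ)}
    (hl : zeroFreq q ≠ l) {z₀ : Fin d → ℂ}
    (hgen : ∀ n, n ≠ zeroFreq q → n ≠ l → leadForm n z₀ ≠ 0) (w : Fin d → ℂ) :
    (asymMat V lam l z₀ 0 w).det = 0 ↔
      (potMat q V (zeroFreq q) (zeroFreq q) - lam - leadForm (zeroFreq q) w) *
        (potMat q V l l - lam - leadForm l w) =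
      potMat q V (zeroFreq q) l * potMat q V l (zeroFreq q) := by
  rw [← Matrix.exists_mulVec_eq_zero_iff]
  set o := zeroFreq q
  have hB : ∀ v : (∀ j, Fin (q j : ℕ)) → ℂ, (∀ n, n ≠ o → n ≠ l → v n = 0) → ∀ n,
      (potMat q V).mulVec v n = potMat q V n o * v o + potMat q V n l * v l := by
    intro v hv n
    exact Fintype.sum_eq_add o l hl fun x hx => by rw [hv x hx.1 hx.2, mul_zero]
  constructor
  · rintro ⟨v, hv0, hv⟩
    have hv' : ∀ n, n ≠ o → n ≠ l → v n = 0 := by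
      intro n hno hnl
      have := congrFun hv n
      rw [asymMat_zero_mulVec, if_neg (not_or.2 ⟨hno, hnl⟩)] at this
      exact (mul_eq_zero.1 this).resolve_left (neg_ne_zero.2 (hgen n hno hnl))
    have e₁ := congrFun hv o
    have e₂ := congrFun hv l
    rw [asymMat_zero_mulVec, if_pos (Or.inl rfl), hB v hv', Pi.zero_apply] at e₁
    rw [asymMat_zero_mulVec, if_pos (Or.inr rfl), hB v hv', Pi.zero_apply] at e₂
    rw [← sub_eq_zero]
    by_cases ho : v o = 0
    · have hvl : v l ≠ 0 := fun h => hv0 <| by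
        funext n
        by_cases h1 : n = o
        · rw [h1, ho, Pi.zero_apply]
        · by_cases h2 : n = l
          · rw [h2, h, Pi.zero_apply]
          · exact hv' n h1 h2
      refine (mul_eq_zero.1 ?_).resolve_right hvl
      linear_combination (potMat q V o o - lam - leadForm o w) * e₂ - potMat q V l o * e₁
    · refine (mul_eq_zero.1 ?_).resolve_right ho
      linear_combination (potMat q V l l - lam - leadForm l w) * e₁ - potMat q V o l * e₂
  · intro h
    have mk : ∀ x y : ℂ, (x ≠ 0 ∨ y ≠ 0) →
        (potMat q V o o - lam - leadForm o w) * x + potMat q V o l * y = 0 →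
        potMat q V l o * x + (potMat q V l l - lam - leadForm l w) * y = 0 →
        ∃ v, v ≠ 0 ∧ (asymMat V lam l z₀ 0 w).mulVec v = 0 := by
      intro x y hxy e₁ e₂
      let v : (∀ j, Fin (q j : ℕ)) → ℂ := Pi.single o x + Pi.single l y
      have vo : v o = x := by simp [v, hl]
      have vl : v l = y := by simp [v, hl.symm]
      have hv' : ∀ n, n ≠ o → n ≠ l → v n = 0 := fun n h1 h2 => by simp [v, h1, h2]
      refine ⟨v, fun h0 => ?_, ?_⟩
      · rw [← vo, ← vl, h0] at hxy
        simp at hxy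
      · funext n
        rw [asymMat_zero_mulVec, hB v hv', vo, vl, Pi.zero_apply]
        split_ifs with hn
        · rcases hn with rfl | rfl
          · rw [vo]
            linear_combination e₁
          · rw [vl]
            linear_combination e₂
        · rw [not_or] at hn
          rw [hv' n hn.1 hn.2, mul_zero]
    by_cases h1 : potMat q V l o = 0 ∧ potMat q V l l - lam - leadForm l w = 0
    · by_cases h2 : potMat q V o o - lam - leadForm o w = 0
      · exact mk 1 0 (Or.inl one_ne_zero) (by rw [h2]; ring) (by rw [h1.1]; ring)
      · refine mk (-potMat q V o l) (potMat q V o o - lam - leadForm o w) (Or.inr h2)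
          (by ring) (by rw [h1.1, h1.2]; ring)
    · rw [not_and_or] at h1
      refine mk (potMat q V l l - lam - leadForm l w) (-potMat q V l o)
        (h1.symm.imp_right neg_ne_zero.2) (by linear_combination h) (by ring)

end Asymptotics

/-! ### Fourier support and separability -/

section Separable

variable {d : ℕ} {q : Fin d → ℕ+}

lemma potMat_zeroFreq_eq_zero_of_separable {Y : (Fin d → ℤ) → ℝ} (hY : IsCompletelySeparable Y)
    {l : ∀ j, Fin (q j : ℕ)} {i k : Fin d} (hik : i ≠ k) (hi : rho (q i) (l i) ≠ 1)
    (hk : rho (q k) (l k) ≠ 1) :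
    potMat q (fun n => (Y n : ℂ)) (zeroFreq q) l = 0 := by
  obtain ⟨f, hf⟩ := hY
  rw [potMat_apply]
  refine mul_eq_zero_of_right _ ?_
  simp only [hf, rho_zeroFreq, inv_one, one_mul, Complex.ofReal_sum, Finset.sum_mul]
  rw [Finset.sum_comm]
  refine Finset.sum_eq_zero fun j _ => ?_
  have h : ∀ p : (∀ j, Fin (q j : ℕ)),
      (f j (boxPt p j) : ℂ) * ∏ a, rho (q a) (l a) ^ (p a : ℕ) =
      ∏ a, (if a = j then (f a ((p a : ℕ) : ℤ) : ℂ) else 1) * rho (q a) (l a) ^ (p a : ℕ) := by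
    intro p
    rw [Finset.prod_mul_distrib, Finset.prod_ite_eq' _ _ _, if_pos (Finset.mem_univ j)]
    rfl
  simp only [h]
  rw [sum_box_prod q fun a x =>
    (if a = j then (f a ((x : ℕ) : ℤ) : ℂ) else 1) * rho (q a) (l a) ^ (x : ℕ)]
  obtain ⟨a, haj, ha⟩ : ∃ a, a ≠ j ∧ rho (q a) (l a) ≠ 1 := by
    by_cases h : i = j
    · exact ⟨k, h ▸ hik.symm, hk⟩
    · exact ⟨i, h, hi⟩
  refine Finset.prod_eq_zero (Finset.mem_univ a) ?_
  simp only [if_neg haj, one_mul]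
  exact sum_pow_eq_zero _ (rho_pow_self _ _) ha

lemma separable_of_potMat {V : (Fin d → ℤ) → ℝ} (hd : 0 < d) (hV : IsPeriodicR q V)
    (h : ∀ (l : ∀ j, Fin (q j : ℕ)) (i k : Fin d), i ≠ k → rho (q i) (l i) ≠ 1 →
      rho (q k) (l k) ≠ 1 → potMat q (fun n => (V n : ℂ)) l (zeroFreq q) = 0) :
    IsCompletelySeparable V := by
  have hexp : ∀ n, (V n : ℂ) = ∑ l, potMat q (fun n => (V n : ℂ)) l (zeroFreq q) *
      ∏ j, rho (q j) (l j) ^ n j := by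
    have hVc : IsPeriodic q (fun n => (V n : ℂ)) := fun n j => by simp only [hV n j]
    have := mul_synth hVc (z := fun _ => 1) (fun _ => one_ne_zero) (Pi.single (zeroFreq q) 1)
    intro n
    have hn := congrFun this n
    rw [Matrix.mulVec_single_one] at hn
    simpa [synth, rho_zeroFreq, Pi.single_apply] using hn
  have hterm : ∀ l : (∀ j, Fin (q j : ℕ)), ∃ g : Fin d → ℤ → ℂ, ∀ n : Fin d → ℤ,
      potMat q (fun n => (V n : ℂ)) l (zeroFreq q) * ∏ j, rho (q j) (l j) ^ n j
        = ∑ j, g j (n j) := by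
    intro l
    obtain ⟨i, hi⟩ : ∃ i : Fin d, ∀ k, k ≠ i → rho (q k) (l k) = 1 ∨
        potMat q (fun n => (V n : ℂ)) l (zeroFreq q) = 0 := by
      by_cases hc : ∃ i, rho (q i) (l i) ≠ 1
      · obtain ⟨i, hi⟩ := hc
        refine ⟨i, fun k hk => ?_⟩
        by_contra! hcon
        exact hcon.2 (h l i k hk.symm hi hcon.1)
      · push Not at hc
        exact ⟨⟨0, hd⟩, fun k _ => Or.inl (hc k)⟩
    refine ⟨fun j x => if j = i then
      potMat q (fun n => (V n : ℂ)) l (zeroFreq q) * rho (q j) (l j) ^ x else 0, fun n => ?_⟩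
    rw [Finset.sum_ite_eq' _ _ _, if_pos (Finset.mem_univ i)]
    by_cases h0 : potMat q (fun n => (V n : ℂ)) l (zeroFreq q) = 0
    · rw [h0, zero_mul, zero_mul]
    · congr 1
      exact Fintype.prod_eq_single i fun k hk => by
        rw [(hi k hk).resolve_right h0, one_zpow]
  choose g hg using hterm
  refine ⟨fun j x => (∑ l, g l j x).re, fun n => ?_⟩
  rw [← Complex.re_sum, Finset.sum_comm, ← Complex.ofReal_re (V n), hexp n]
  simp only [hg]

end Separable

lemma potMat_eq_zero_of_subset {d : ℕ} (hd : 3 ≤ d) {q : Fin d → ℕ+}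
    (hq : ∀ i j, i ≠ j → Nat.Coprime (q i) (q j)) {V Y : (Fin d → ℤ) → ℂ}
    (hV : IsPeriodic q V) (hY : IsPeriodic q Y) {lam : ℂ}
    (hsub : FermiVariety q Y lam ⊆ FermiVariety q V lam)
    {l : ∀ j, Fin (q j : ℕ)} {i k : Fin d} (hik : i ≠ k) (hi : rho (q i) (l i) ≠ 1)
    (hk : rho (q k) (l k) ≠ 1) (hYl : potMat q Y (zeroFreq q) l = 0) :
    potMat q V (zeroFreq q) l * potMat q V l (zeroFreq q) = 0 := by
  have hl : zeroFreq q ≠ l := fun h => hi (h ▸ rho_zeroFreq i)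
  obtain ⟨z₀, h0, hl0, hz⟩ := exists_generic (leadForm (zeroFreq q)) (leadForm l)
    (ι := {n : (∀ j, Fin (q j : ℕ)) // n ≠ zeroFreq q ∧ n ≠ l} ⊕ Fin d)
    (Sum.elim (fun n => leadForm n.1) fun j => LinearMap.proj j) (by
      rintro (n | j)
      · exact fun h => not_or.2 n.2 (eq_or_eq_of_leadForm_mem_span hd hq hik hi hk h)
      · exact proj_notMem_span_leadForm hd hq hik hi hk j)
  have hgen : ∀ n, n ≠ zeroFreq q → n ≠ l → leadForm n z₀ ≠ 0 :=
    fun n h1 h2 => hz (Sum.inl ⟨n, h1, h2⟩)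
  have hz₀ : ∀ j, z₀ j ≠ 0 := fun j => hz (Sum.inr j)
  obtain ⟨w₁, w₂, h11, h21, h12, h22⟩ := exists_leadForm_eq (rho_ne_rho hq l hik hi)
  set μV := potMat q V l l - lam with hμV
  set μY := potMat q Y l l - lam with hμY
  have key : ∀ b : ℂ, b ≠ μY →
      (μV - μY) * (μV - b) = potMat q V (zeroFreq q) l * potMat q V l (zeroFreq q) := by
    intro b hb
    let w : ℂ → Fin d → ℂ := fun s => (μY + s) • w₁ + b • w₂
    have hw : Differentiable ℂ w := by fun_prop
    have hw0 : ∀ s, leadForm (zeroFreq q) (w s) = μY + s := fun s => by simp [w, h11, h12]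
    have hwl : ∀ s, leadForm l (w s) = b := fun s => by simp [w, h21, h22]
    let U : Set (ℂ × ℂ) := {x | ∀ j, z₀ j + x.1 * w x.2 j ≠ 0}
    have hU : IsOpen U := by
      have : U = ⋂ j, {x : ℂ × ℂ | z₀ j + x.1 * w x.2 j ≠ 0} := by
        ext x
        simp [U]
      rw [this]
      refine isOpen_iInter_of_finite fun j => isOpen_ne_fun ?_ continuous_const
      have := (continuous_apply j).comp (hw.continuous.comp (continuous_snd (X := ℂ)))
      exact continuous_const.add (continuous_fst.mul this)
    have hFzero : ∀ s, (asymMat Y lam l z₀ 0 (w s)).det = 0 ↔ s = 0 := by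
      intro s
      rw [det_asymMat_zero_iff Y lam hl hgen, hw0, hwl, potMat_diag q Y _ l, hYl, zero_mul,
        ← hμY, mul_eq_zero, or_iff_left (sub_ne_zero.2 hb.symm)]
      simp
    have := eq_zero_of_zeros_subset (G := fun x => (asymMat V lam l z₀ x.1 (w x.2)).det) hU
      (differentiableOn_det_asymMat Y lam l z₀ hw)
      (differentiableOn_det_asymMat V lam l z₀ hw).continuousOn
      (fun s j => by simpa using hz₀ j) ((hFzero 0).2 rfl) (fun s hs h => hs ((hFzero s).1 h))
      (fun t s ht hts hs => by
        refine (det_asymMat_eq_zero_iff V lam h0 hl0 ht _).2 ?_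
        refine det_floquetMat_eq_zero_of_subset hV hY hsub (fun j => ?_)
          ((det_asymMat_eq_zero_iff Y lam h0 hl0 ht _).1 hs)
        have : (t⁻¹ • z₀ + w s) j = t⁻¹ * (z₀ j + t * w s j) := by
          simp only [Pi.add_apply, Pi.smul_apply, smul_eq_mul]
          field_simp
        rw [this]
        exact mul_ne_zero (inv_ne_zero ht) (hts j))
    rw [det_asymMat_zero_iff V lam hl hgen, hw0, hwl, potMat_diag q V _ l, ← hμV, add_zero] at this
    exact this
  have k₁ := key (μY + 1) (by simp)
  have k₂ := key (μY + 2) (by simp)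
  linear_combination (μV - μY - 1) * (k₁ - k₂) - k₁

/-- Let `d ≥ 3` and let `V`, `Y` be real `Γ`-periodic potentials
on `ℤ^d` that are Fermi isospectral.  If `Y` is completely separable, then so
is `V`. -/
theorem statement13 (d : ℕ) (hd : 3 ≤ d) (q : Fin d → ℕ+)
    (hq : ∀ i j, i ≠ j → Nat.Coprime (q i) (q j))
    (V Y : (Fin d → ℤ) → ℝ) (hV : IsPeriodicR q V) (hY : IsPeriodicR q Y)
    (lam0 : ℂ)
    (hiso : FermiVariety q (fun n => ((V n : ℝ) : ℂ)) lam0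
      = FermiVariety q (fun n => ((Y n : ℝ) : ℂ)) lam0)
    (hsep : IsCompletelySeparable Y) :
    IsCompletelySeparable V := by
  have hVc : IsPeriodic q (fun n => (V n : ℂ)) := fun n j => by simp only [hV n j]
  have hYc : IsPeriodic q (fun n => (Y n : ℂ)) := fun n j => by simp only [hY n j]
  refine separable_of_potMat (by omega) hV fun l i k hik hi hk => ?_
  have h := potMat_eq_zero_of_subset hd hq hVc hYc hiso.ge hik hi hk
    (potMat_zeroFreq_eq_zero_of_separable hsep hik hi hk)
  rw [← star_potMat q V l] at h
  exact (mul_eq_zero.1 h).elim star_eq_zero.1 id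

end
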